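/- arXiv:2508.04813 — 2 statements merged into one kernel-verified Lean document; each statement's English description precedes it below -/
import Mathlib

section
/- Let d ≥ 2 be an integer, let G be an additively written abelian group, let 𝒰ℓ, 𝒰r, 𝒮ℓ, 𝒮r be finite sets, and set 𝒮 := 𝒮ℓ⊔𝒮r. Let v : (𝒰ℓ⊔𝒰r)×𝒜 → G and z : 𝒮×ℬ → G be any functions, written v_R^i := v(R,i) and z_t^j := z(t,j). For i ∈ 𝒜, let ♣(i) denote the equation Σ_{R∈𝒰r}(v_R^i+v_R^î) − Σ_{R∈𝒰ℓ}(v_R^i+v_R^î) = Σ_{t∈𝒮ℓ}Σ_{j∈ℬ, j₂=i₂} z_t^j − Σ_{t∈𝒮r}Σ_{j∈ℬ, j₂=i₁} z_t^j, and let ♠(i) denote the equation Σ_{t∈𝒮}Σ_{j∈ℬ, j₂=i₂} z_t^j = Σ_{t∈𝒮}Σ_{j∈ℬ, j₂=i₁} z_t^j. Then ♣(i) holds for all i ∈ 𝒜 if and only if ♣(i) holds for all i ∈ 𝒜'' and ♠(i) holds for all i ∈ 𝒜'. -/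
/-- `𝒜`: pairs of positive integers summing to `d`. -/
def Aset (d : ℕ) : Finset (ℕ × ℕ) :=
  (Finset.range (d + 1) ×ˢ Finset.range (d + 1)).filter
    fun i => 0 < i.1 ∧ 0 < i.2 ∧ i.1 + i.2 = d

/-- `ℬ`: triples of positive integers summing to `d`. -/
def Bset (d : ℕ) : Finset (ℕ × ℕ × ℕ) :=
  (Finset.range (d + 1) ×ˢ Finset.range (d + 1) ×ˢ Finset.range (d + 1)).filter
    fun j => 0 < j.1 ∧ 0 < j.2.1 ∧ 0 < j.2.2 ∧ j.1 + j.2.1 + j.2.2 = d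

/-- `𝒜' = {(i₁,i₂) ∈ 𝒜 : i₁ ≤ ⌊(d-1)/2⌋}`. -/
def A1set (d : ℕ) : Finset (ℕ × ℕ) := (Aset d).filter fun i => i.1 ≤ (d - 1) / 2

/-- `𝒜'' = {(i₁,i₂) ∈ 𝒜 : i₁ ≤ ⌈(d-1)/2⌉}` (note `⌈(d-1)/2⌉ = d/2` in natural division). -/
def A2set (d : ℕ) : Finset (ℕ × ℕ) := (Aset d).filter fun i => i.1 ≤ d / 2

/-- `ℬ* = {(j₁,j₂,j₃) ∈ ℬ : j₁, j₂, j₃ ≤ ⌊(d-1)/2⌋}`. -/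
def Bstar (d : ℕ) : Finset (ℕ × ℕ × ℕ) :=
  (Bset d).filter fun j => j.1 ≤ (d - 1) / 2 ∧ j.2.1 ≤ (d - 1) / 2 ∧ j.2.2 ≤ (d - 1) / 2

/-- The triples in `ℬ` with middle entry equal to `k`. -/
def Bmid (d k : ℕ) : Finset (ℕ × ℕ × ℕ) := (Bset d).filter fun j => j.2.1 = k

/-- `ℬ⁰ = {j ∈ ℬ : j₂ = d/2}` (for `d` even). -/
def Bzero (d : ℕ) : Finset (ℕ × ℕ × ℕ) := Bmid d (d / 2)

section Statement17

variable {G : Type*} [AddCommGroup G] {Uℓ Ur Sℓ Sr : Type*}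
  [Fintype Uℓ] [Fintype Ur] [Fintype Sℓ] [Fintype Sr]

/-- Equation `♣(i)`. -/
def ClubEq (d : ℕ) (v : (Uℓ ⊕ Ur) → (ℕ × ℕ) → G) (z : (Sℓ ⊕ Sr) → (ℕ × ℕ × ℕ) → G)
    (i : ℕ × ℕ) : Prop :=
  (∑ R : Ur, (v (Sum.inr R) i + v (Sum.inr R) (i.2, i.1))) -
      (∑ R : Uℓ, (v (Sum.inl R) i + v (Sum.inl R) (i.2, i.1))) =
    (∑ t : Sℓ, ∑ j ∈ Bmid d i.2, z (Sum.inl t) j) -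
      (∑ t : Sr, ∑ j ∈ Bmid d i.1, z (Sum.inr t) j)

/-- Equation `♠(i)`. -/
def SpadeEq (d : ℕ) (z : (Sℓ ⊕ Sr) → (ℕ × ℕ × ℕ) → G) (i : ℕ × ℕ) : Prop :=
  (∑ t : Sℓ ⊕ Sr, ∑ j ∈ Bmid d i.2, z t j) = ∑ t : Sℓ ⊕ Sr, ∑ j ∈ Bmid d i.1, z t j

/-- The left-hand side of `♣(i)` is invariant under swapping the entries of `i`, so `♣` at `i` and
at its swap differ exactly by `♠(i)`. -/
theorem ClubEq.swap_iff_spadeEq {d : ℕ} {v : (Uℓ ⊕ Ur) → (ℕ × ℕ) → G}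
    {z : (Sℓ ⊕ Sr) → (ℕ × ℕ × ℕ) → G} {i : ℕ × ℕ} (h : ClubEq d v z i) :
    ClubEq d v z i.swap ↔ SpadeEq d z i := by
  have comm : ∀ R, v R i.swap + v R i = v R i + v R i.swap := fun R => add_comm _ _
  change (∑ R : Ur, (v (Sum.inr R) i.swap + v (Sum.inr R) i)) -
      (∑ R : Uℓ, (v (Sum.inl R) i.swap + v (Sum.inl R) i)) = _ - _ ↔ _
  simp only [comm]
  rw [SpadeEq, Fintype.sum_sum_type, Fintype.sum_sum_type, ← sub_eq_sub_iff_add_eq_add]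
  exact ⟨fun h' => h.symm.trans h', h.trans⟩

/-- Lemma 5.4: the equations `♣(i)` hold for all `i ∈ 𝒜` iff `♣(i)` holds for
all `i ∈ 𝒜''` and `♠(i)` holds for all `i ∈ 𝒜'`. -/
theorem club_iff_club_and_spade
    (d : ℕ) (hd : 2 ≤ d)
    (v : (Uℓ ⊕ Ur) → (ℕ × ℕ) → G) (z : (Sℓ ⊕ Sr) → (ℕ × ℕ × ℕ) → G) :
    (∀ i ∈ Aset d, ClubEq d v z i) ↔
      ((∀ i ∈ A2set d, ClubEq d v z i) ∧ (∀ i ∈ A1set d, SpadeEq d z i)) := by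
  constructor
  · intro h
    refine ⟨fun i hi => h i (Finset.mem_filter.mp hi).1, fun i hi => ?_⟩
    have hi' := (Finset.mem_filter.mp hi).1
    refine (h i hi').swap_iff_spadeEq.mp (h i.swap ?_)
    simp only [Aset, Finset.mem_filter, Finset.mem_product, Finset.mem_range, Prod.fst_swap,
      Prod.snd_swap] at hi' ⊢
    omega
  · rintro ⟨hclub, hspade⟩ i hi
    by_cases hle : i.1 ≤ d / 2
    · exact hclub i (Finset.mem_filter.mpr ⟨hi, hle⟩)
    · have h₂ : i.swap ∈ A2set d := by
        simp only [A2set, Aset, Finset.mem_filter, Finset.mem_product, Finset.mem_range,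
          Prod.fst_swap, Prod.snd_swap] at hi ⊢
        omega
      have h₁ : i.swap ∈ A1set d := by
        simp only [A1set, Aset, Finset.mem_filter, Finset.mem_product, Finset.mem_range,
          Prod.fst_swap, Prod.snd_swap] at hi ⊢
        omega
      exact (hclub _ h₂).swap_iff_spadeEq.mpr (hspade _ h₁)

end Statement17
end

section
/- Let d ≥ 2 be an integer, let G be an additively written abelian group, let Δ, 𝒪, 𝒰ℓ, 𝒰r be finite sets, set 𝒰 := 𝒰ℓ⊔𝒰r and 𝒮 := Δ×(ℤ/3ℤ), and fix a partition 𝒮 = 𝒮ℓ⊔𝒮r. Let v : (𝒪⊔𝒰)×𝒜 → G and z : 𝒮×ℬ → G be maps such that z satisfies ♦(t,j) for all t∈𝒮 and j∈ℬ. Define tor'(v,z) ∈ G by tor'(v,z) := −Σ_{T∈Δ}Σ_{j∈ℬ*} z_{(T,0)}^j if d is odd, and tor'(v,z) := −Σ_{T∈Δ}Σ_{j∈ℬ*} z_{(T,0)}^j + Σ_{R∈𝒰r} v_R^{i⁰} − Σ_{R∈𝒰ℓ} v_R^{i⁰} − Σ_{t∈𝒮ℓ}Σ_{j∈ℬ⁰}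 z_t^j if d is even. Then ♣(i) holds for all i ∈ 𝒜 if and only if all of the following hold: ♣(i) for all i ∈ 𝒜'', ♠(i) for all i ∈ 𝒜'∖{(1,d−1)}, and d·tor'(v,z) = 0. -/
theorem mem_Aset {d : ℕ} {i : ℕ × ℕ} :
    i ∈ Aset d ↔ 0 < i.1 ∧ 0 < i.2 ∧ i.1 + i.2 = d := by
  simp only [Aset, Finset.mem_filter, Finset.mem_product, Finset.mem_range]
  omega

theorem mem_Bset {d : ℕ} {j : ℕ × ℕ × ℕ} :
    j ∈ Bset d ↔ 0 < j.1 ∧ 0 < j.2.1 ∧ 0 < j.2.2 ∧ j.1 + j.2.1 + j.2.2 = d := by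
  simp only [Bset, Finset.mem_filter, Finset.mem_product, Finset.mem_range]
  omega

/-- The sum of `k` times the indicator of `a = k`, minus `k` times the indicator of `a = d - k`,
over `1 ≤ k ≤ ⌊(d-1)/2⌋`. -/
def signedDefect (d a : ℕ) : ℤ :=
  ∑ k ∈ Finset.Icc 1 ((d - 1) / 2), (k : ℤ) * ((if a = k then 1 else 0) - if a = d - k then 1 else 0)

theorem signedDefect_eq {d a : ℕ} (ha : 0 < a) (had : a < d) :
    signedDefect d a =
      if a ≤ (d - 1) / 2 then (a : ℤ) else if 2 * a = d then 0 else (a : ℤ) - d := by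
  simp only [signedDefect, mul_sub, Finset.sum_sub_distrib, mul_ite, mul_one, mul_zero]
  have h : ∑ k ∈ Finset.Icc 1 ((d - 1) / 2), (if a = d - k then (k : ℤ) else 0) =
      ∑ k ∈ Finset.Icc 1 ((d - 1) / 2), if d - a = k then (k : ℤ) else 0 :=
    Finset.sum_congr rfl fun k hk => by
      rw [Finset.mem_Icc] at hk
      exact if_congr (by omega) rfl rfl
  rw [h, Finset.sum_ite_eq, Finset.sum_ite_eq]
  simp only [Finset.mem_Icc]
  split_ifs <;> omega

theorem signedDefect_add_add {d : ℕ} {j : ℕ × ℕ × ℕ} (hj : j ∈ Bset d) :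
    signedDefect d j.1 + signedDefect d j.2.1 + signedDefect d j.2.2 =
      (if j ∈ Bstar d then (d : ℤ) else 0) +
        if d % 2 = 0 then
          ((d / 2 : ℕ) : ℤ) * ((if j.1 = d / 2 then 1 else 0) + (if j.2.1 = d / 2 then 1 else 0) +
            if j.2.2 = d / 2 then 1 else 0)
        else 0 := by
  have hs : j ∈ Bstar d ↔
      j.1 ≤ (d - 1) / 2 ∧ j.2.1 ≤ (d - 1) / 2 ∧ j.2.2 ≤ (d - 1) / 2 := by
    simp [Bstar, hj]
  rw [mem_Bset] at hj
  simp only [hs]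
  obtain ⟨a, b, c⟩ := j
  dsimp only at hj ⊢
  rw [signedDefect_eq (by omega) (by omega), signedDefect_eq (by omega) (by omega),
    signedDefect_eq (by omega) (by omega)]
  by_cases he : d % 2 = 0
  · rw [if_pos he]
    by_cases ha : a = d / 2
    · simp only [ha, show b ≠ d / 2 by omega, show c ≠ d / 2 by omega, if_true, if_false]
      split_ifs <;> omega
    by_cases hb : b = d / 2
    · simp only [hb, ha, show c ≠ d / 2 by omega, if_true, if_false]
      split_ifs <;> omega
    by_cases hc : c = d / 2
    · simp only [hb, ha, hc, if_true, if_false]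
      split_ifs <;> omega
    simp only [ha, hb, hc, if_false]
    split_ifs <;> omega
  · rw [if_neg he]
    split_ifs <;> omega

section Statement19

variable {G : Type*} [AddCommGroup G] {Δ O Uℓ Ur : Type*}
  [Fintype Δ] [DecidableEq Δ] [Fintype Uℓ] [Fintype Ur]

/-- The left-hand side of equation `♣(i)`. -/
def ClubLHS (v : (O ⊕ (Uℓ ⊕ Ur)) → (ℕ × ℕ) → G) (i : ℕ × ℕ) : G :=
  (∑ R : Ur, (v (Sum.inr (Sum.inr R)) i + v (Sum.inr (Sum.inr R)) (i.2, i.1))) -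
    (∑ R : Uℓ, (v (Sum.inr (Sum.inl R)) i + v (Sum.inr (Sum.inl R)) (i.2, i.1)))

/-- The right-hand side of equation `♣(i)`, with `𝒮ℓ` the finset `SL` and `𝒮r` its complement. -/
def ClubRHS (d : ℕ) (SL : Finset (Δ × ZMod 3)) (z : (Δ × ZMod 3) → (ℕ × ℕ × ℕ) → G)
    (i : ℕ × ℕ) : G :=
  (∑ t ∈ SL, ∑ j ∈ Bmid d i.2, z t j) - ∑ t ∈ SLᶜ, ∑ j ∈ Bmid d i.1, z t j

/-- The conditions `♦(t, j)` for all `t ∈ 𝒮 = Δ × ℤ/3ℤ` and `j ∈ ℬ`: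
`z_t^j = z_{t₊}^{j₊} = z_{t₋}^{j₋}`. -/
def DiamondCond (d : ℕ) (z : (Δ × ZMod 3) → (ℕ × ℕ × ℕ) → G) : Prop :=
  ∀ t : Δ × ZMod 3, ∀ j ∈ Bset d,
    z t j = z (t.1, t.2 + 1) (j.2.1, j.2.2, j.1) ∧
    z t j = z (t.1, t.2 + 2) (j.2.2, j.1, j.2.1)

/-- Equation `♠(i)`, summing over all `t ∈ 𝒮 = Δ × ℤ/3ℤ`. -/
def SpadeEq' (d : ℕ) (z : (Δ × ZMod 3) → (ℕ × ℕ × ℕ) → G) (i : ℕ × ℕ) : Prop :=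
  (∑ t : Δ × ZMod 3, ∑ j ∈ Bmid d i.2, z t j) = ∑ t : Δ × ZMod 3, ∑ j ∈ Bmid d i.1, z t j

/-- The element `tor'(v,z) ∈ G`. -/
def torPrime (d : ℕ) (SL : Finset (Δ × ZMod 3))
    (v : (O ⊕ (Uℓ ⊕ Ur)) → (ℕ × ℕ) → G) (z : (Δ × ZMod 3) → (ℕ × ℕ × ℕ) → G) : G :=
  if d % 2 = 0 then
    -(∑ T : Δ, ∑ j ∈ Bstar d, z (T, 0) j) +
      (∑ R : Ur, v (Sum.inr (Sum.inr R)) (d / 2, d / 2)) -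
      (∑ R : Uℓ, v (Sum.inr (Sum.inl R)) (d / 2, d / 2)) -
      ∑ t ∈ SL, ∑ j ∈ Bzero d, z t j
  else -(∑ T : Δ, ∑ j ∈ Bstar d, z (T, 0) j)

end Statement19

section MidSum

variable {G : Type*} [AddCommGroup G] {Δ : Type*} [Fintype Δ]

/-- The sum of `z_t^j` over all `t ∈ 𝒮` and all `j ∈ ℬ` with `j₂ = k`. -/
def midSum (d : ℕ) (z : (Δ × ZMod 3) → (ℕ × ℕ × ℕ) → G) (k : ℕ) : G :=
  ∑ t : Δ × ZMod 3, ∑ j ∈ Bmid d k, z t j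

theorem midSum_eq_sum_ite (d : ℕ) (z : (Δ × ZMod 3) → (ℕ × ℕ × ℕ) → G) (k : ℕ) :
    midSum d z k =
      ∑ t : Δ × ZMod 3, ∑ j ∈ Bset d, (if j.2.1 = k then (1 : ℤ) else 0) • z t j := by
  simp only [midSum, Bmid, Finset.sum_filter, ite_smul, one_smul, zero_smul]

theorem sum_Bset_rotate (d : ℕ) (f : ℕ × ℕ × ℕ → G) :
    ∑ j ∈ Bset d, f (j.2.1, j.2.2, j.1) = ∑ j ∈ Bset d, f j := by
  refine Finset.sum_bij' (fun j _ => (j.2.1, j.2.2, j.1)) (fun j _ => (j.2.2, j.1, j.2.1))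
    ?_ ?_ ?_ ?_ ?_ <;> intro j hj
  · rw [mem_Bset] at *
    dsimp only
    omega
  · rw [mem_Bset] at *
    dsimp only
    omega
  all_goals rfl

theorem DiamondCond.sum_smul {d : ℕ} {z : (Δ × ZMod 3) → (ℕ × ℕ × ℕ) → G}
    (hz : DiamondCond d z) (f : ℕ → ℤ) :
    ∑ t : Δ × ZMod 3, ∑ j ∈ Bset d, f j.2.1 • z t j =
      ∑ T : Δ, ∑ j ∈ Bset d, (f j.1 + f j.2.1 + f j.2.2) • z (T, 0) j := by
  rw [Fintype.sum_prod_type]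
  refine Finset.sum_congr rfl fun T _ => ?_
  have h1 : ∑ j ∈ Bset d, f j.2.1 • z (T, 1) j = ∑ j ∈ Bset d, f j.2.2 • z (T, 0) j := by
    rw [← sum_Bset_rotate]
    refine Finset.sum_congr rfl fun j hj => ?_
    rw [(hz (T, 0) j hj).1, zero_add]
  have h2 : ∑ j ∈ Bset d, f j.2.1 • z (T, 2) j = ∑ j ∈ Bset d, f j.1 • z (T, 0) j := by
    rw [← sum_Bset_rotate, ← sum_Bset_rotate]
    refine Finset.sum_congr rfl fun j hj => ?_
    rw [(hz (T, 0) j hj).2, zero_add]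
  change ∑ k : Fin 3, ∑ j ∈ Bset d, f j.2.1 • z (T, k) j = _
  rw [Fin.sum_univ_three]
  refine (congrArg₂ (· + ·) (congrArg₂ (· + ·) rfl h1) h2).trans ?_
  simp only [add_smul, Finset.sum_add_distrib]
  rw [add_rotate, add_rotate]
  rfl

theorem sum_smul_midSum_sub (d : ℕ) (z : (Δ × ZMod 3) → (ℕ × ℕ × ℕ) → G) :
    ∑ k ∈ Finset.Icc 1 ((d - 1) / 2), k • (midSum d z k - midSum d z (d - k)) =
      ∑ t : Δ × ZMod 3, ∑ j ∈ Bset d, signedDefect d j.2.1 • z t j := by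
  simp only [midSum_eq_sum_ite, signedDefect, ← Finset.sum_sub_distrib, ← sub_smul,
    Finset.smul_sum, Finset.sum_smul, mul_smul, natCast_zsmul]
  rw [Finset.sum_comm]
  exact Finset.sum_congr rfl fun t _ => Finset.sum_comm

theorem DiamondCond.sum_smul_midSum_sub {d : ℕ} {z : (Δ × ZMod 3) → (ℕ × ℕ × ℕ) → G}
    (hz : DiamondCond d z) :
    ∑ k ∈ Finset.Icc 1 ((d - 1) / 2), k • (midSum d z k - midSum d z (d - k)) =
      d • (∑ T : Δ, ∑ j ∈ Bstar d, z (T, 0) j) +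
        if d % 2 = 0 then (d / 2) • midSum d z (d / 2) else 0 := by
  rw [_root_.sum_smul_midSum_sub, hz.sum_smul, midSum_eq_sum_ite,
    hz.sum_smul fun a => if a = d / 2 then 1 else 0]
  have hB : ∀ T : Δ, ∑ j ∈ Bstar d, z (T, 0) j =
      ∑ j ∈ Bset d, if j ∈ Bstar d then z (T, 0) j else 0 := fun T => by
    rw [← Finset.sum_filter, Finset.filter_mem_eq_inter,
      Finset.inter_eq_right.2 (show Bstar d ⊆ Bset d from Finset.filter_subset _ _)]
  simp only [hB, Finset.smul_sum]
  split_ifs with he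
  · simp only [← Finset.sum_add_distrib]
    refine Finset.sum_congr rfl fun T _ => Finset.sum_congr rfl fun j hj => ?_
    rw [signedDefect_add_add hj, if_pos he, add_smul, mul_smul, natCast_zsmul]
    split_ifs <;> simp
  · rw [add_zero]
    refine Finset.sum_congr rfl fun T _ => Finset.sum_congr rfl fun j hj => ?_
    rw [signedDefect_add_add hj, if_neg he, add_zero]
    split_ifs <;> simp

end MidSum

section Statement19

variable {G : Type*} [AddCommGroup G] {Δ O Uℓ Ur : Type*}
  [Fintype Δ] [DecidableEq Δ] [Fintype Uℓ] [Fintype Ur]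

theorem clubRHS_sub_clubRHS_swap (d : ℕ) (SL : Finset (Δ × ZMod 3))
    (z : (Δ × ZMod 3) → (ℕ × ℕ × ℕ) → G) (i : ℕ × ℕ) :
    ClubRHS d SL z i - ClubRHS d SL z i.swap = midSum d z i.2 - midSum d z i.1 := by
  simp only [ClubRHS, midSum, Prod.fst_swap, Prod.snd_swap,
    ← Finset.sum_add_sum_compl SL fun t => ∑ j ∈ Bmid d _, z t j]
  abel

theorem clubLHS_swap (v : (O ⊕ (Uℓ ⊕ Ur)) → (ℕ × ℕ) → G) (i : ℕ × ℕ) :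
    ClubLHS v i.swap = ClubLHS v i := by
  obtain ⟨a, b⟩ := i
  simp only [ClubLHS, Prod.swap_prod_mk, add_comm]

theorem club_swap_iff {d : ℕ} {SL : Finset (Δ × ZMod 3)}
    {v : (O ⊕ (Uℓ ⊕ Ur)) → (ℕ × ℕ) → G} {z : (Δ × ZMod 3) → (ℕ × ℕ × ℕ) → G} {i : ℕ × ℕ}
    (h : ClubLHS v i = ClubRHS d SL z i) :
    ClubLHS v i.swap = ClubRHS d SL z i.swap ↔ SpadeEq' d z i := by
  change _ ↔ midSum d z i.2 = midSum d z i.1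
  rw [← sub_eq_zero (a := midSum d z i.2), ← clubRHS_sub_clubRHS_swap d SL, ← h, clubLHS_swap,
    sub_eq_zero]

theorem smul_torPrime {d : ℕ} (hd : 2 ≤ d) {SL : Finset (Δ × ZMod 3)}
    {v : (O ⊕ (Uℓ ⊕ Ur)) → (ℕ × ℕ) → G} {z : (Δ × ZMod 3) → (ℕ × ℕ × ℕ) → G}
    (hz : DiamondCond d z) (h : ∀ i ∈ A2set d, ClubLHS v i = ClubRHS d SL z i) :
    d • torPrime d SL v z =
      -∑ k ∈ Finset.Icc 1 ((d - 1) / 2), k • (midSum d z k - midSum d z (d - k)) := by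
  rw [hz.sum_smul_midSum_sub, torPrime]
  split_ifs with he
  · have hm : (d / 2, d / 2) ∈ A2set d := by
      rw [A2set, Finset.mem_filter, mem_Aset]
      dsimp only
      omega
    have hc := congrArg (fun x => (d / 2) • x) (h _ hm)
    simp only [ClubLHS, ClubRHS, midSum, Finset.sum_add_distrib] at hc ⊢
    rw [← Finset.sum_add_sum_compl SL, Bzero]
    obtain ⟨m, rfl⟩ : ∃ m, d = 2 * m := ⟨d / 2, by omega⟩
    rw [Nat.mul_div_cancel_left m two_pos] at hc ⊢
    rw [← sub_eq_zero] at hc ⊢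
    rw [← hc, mul_comm, mul_smul, mul_smul]
    simp only [two_smul, smul_add, smul_sub, smul_neg]
    abel
  · simp

/-- Lemma 5.6: if `z` satisfies `♦(t,j)` for all `t ∈ 𝒮` and `j ∈ ℬ`, then
`♣(i)` holds for all `i ∈ 𝒜` iff `♣(i)` holds for all `i ∈ 𝒜''`, `♠(i)` holds for all
`i ∈ 𝒜' ∖ {(1, d-1)}`, and `d • tor'(v,z) = 0`. -/
theorem club_iff_club_spade_torsion
    (d : ℕ) (hd : 2 ≤ d) (SL : Finset (Δ × ZMod 3))
    (v : (O ⊕ (Uℓ ⊕ Ur)) → (ℕ × ℕ) → G) (z : (Δ × ZMod 3) → (ℕ × ℕ × ℕ) → G)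
    (hz : DiamondCond d z) :
    (∀ i ∈ Aset d, ClubLHS v i = ClubRHS d SL z i) ↔
      ((∀ i ∈ A2set d, ClubLHS v i = ClubRHS d SL z i) ∧
       (∀ i ∈ (A1set d).erase (1, d - 1), SpadeEq' d z i) ∧
       d • torPrime d SL v z = 0) := by
  refine ⟨fun h => ?_, fun ⟨h, hs, ht⟩ => ?_⟩
  · have h2 : ∀ i ∈ A2set d, ClubLHS v i = ClubRHS d SL z i :=
      fun i hi => h i (Finset.filter_subset _ _ hi)
    have hs : ∀ i ∈ Aset d, SpadeEq' d z i := fun i hi =>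
      (club_swap_iff (h i hi)).1 <| h _ <| by
        rw [mem_Aset] at *
        simp only [Prod.fst_swap, Prod.snd_swap]
        omega
    refine ⟨h2, fun i hi => hs i (Finset.filter_subset _ _ (Finset.mem_of_mem_erase hi)), ?_⟩
    rw [smul_torPrime hd hz h2, neg_eq_zero]
    refine Finset.sum_eq_zero fun k hk => ?_
    rw [Finset.mem_Icc] at hk
    have hk' := hs (k, d - k) (mem_Aset.2 (by dsimp only; omega))
    rw [sub_eq_zero.2 (show midSum d z k = midSum d z (d - k) from hk'.symm), smul_zero]
  · have h1 : ∀ i ∈ A1set d, SpadeEq' d z i := by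
      intro i hi
      by_cases hi1 : i = (1, d - 1)
      swap
      · exact hs i (Finset.mem_erase.2 ⟨hi1, hi⟩)
      subst hi1
      have hd1 : 1 ≤ (d - 1) / 2 := (Finset.mem_filter.1 hi).2
      rw [smul_torPrime hd hz h, neg_eq_zero, Finset.sum_eq_single_of_mem 1
        (Finset.mem_Icc.2 ⟨le_rfl, hd1⟩), one_smul, sub_eq_zero] at ht
      · exact ht.symm
      · intro k hk hk1
        rw [Finset.mem_Icc] at hk
        have hk' := hs (k, d - k) <| by
          simp only [A1set, Finset.mem_erase, Finset.mem_filter, mem_Aset, ne_eq, Prod.mk.injEq]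
          omega
        rw [sub_eq_zero.2 (show midSum d z k = midSum d z (d - k) from hk'.symm), smul_zero]
    intro i hi
    by_cases hi2 : i.1 ≤ d / 2
    · exact h i (Finset.mem_filter.2 ⟨hi, hi2⟩)
    · rw [mem_Aset] at hi
      have hA : i.swap ∈ Aset d := by
        rw [mem_Aset]
        simp only [Prod.fst_swap, Prod.snd_swap]
        omega
      have hw : i.swap.1 ≤ (d - 1) / 2 := by
        simp only [Prod.fst_swap]
        omega
      have hc := (club_swap_iff (h i.swap (Finset.mem_filter.2 ⟨hA, by omega⟩))).2
        (h1 i.swap (Finset.mem_filter.2 ⟨hA, hw⟩))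
      rwa [Prod.swap_swap] at hc

end Statement19
end
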